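/- Second ratio simplification in the recurrence check: for all integers r, c, n ≥ 1 with d = min(r,c), the following identity holds in ℚ(a,q): [φ(r,c,n-1) / φ(r,c,n)] · [φ(r-1,c-1,n+1) / φ(r-1,c-1,n)] = a q^{r+c-1} · [(1 - a q^{n})^{d-1} / (1 - q^{n})^{d-1}] · [(1 - q^{n+1})^{d-1} / (1 - a q^{n+1})^{d-1}] · (1 - a q^{n}) / (1 - a q^{r+c+n-1}). -/

import Mathlib

open Finset

noncomputable section

/-- The field `ℚ(a,q)` of rational functions in two indeterminates over `ℚ`. -/
abbrev Kaq : Type := FractionRing (MvPolynomial (Fin 2) ℚ)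

/-- The indeterminate `a` in `ℚ(a,q)`. -/
def av : Kaq := algebraMap (MvPolynomial (Fin 2) ℚ) Kaq (MvPolynomial.X 0)

/-- The indeterminate `q` in `ℚ(a,q)`. -/
def qv : Kaq := algebraMap (MvPolynomial (Fin 2) ℚ) Kaq (MvPolynomial.X 1)

/-- The q-Pochhammer symbol `(x; q)_N = ∏_{m=0}^{N-1} (1 - x qᵐ)`. -/
def poch {K : Type*} [Field K] (x q : K) (N : ℕ) : K :=
  ∏ m ∈ Finset.range N, (1 - x * q ^ m)

/-- `A(r,c,n) = ∏_{i=1}^{min(r,c)} (a q^{n+i-1}; q⁻¹)_{i-1} / (q^{n+i-1}; q⁻¹)_{i-1}`. -/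
def Afun (r c n : ℕ) : Kaq :=
  ∏ i ∈ Finset.Icc 1 (min r c),
    poch (av * qv ^ (n + i - 1)) qv⁻¹ (i - 1) / poch (qv ^ (n + i - 1)) qv⁻¹ (i - 1)

/-- The explicit product
`φ(r,c,n) = a^{-d(d+1)/2 - (n+1)d} q^{-c(r(r+1)/2 + (n-1)r)} A(r,c,n)`
`· ∏_{i=1}^r ∏_{j=1}^c ∏_{k=1}^n (1 - a q^{i+j+k-1})/(1 - a q^{i+j+k-2})`,
where `d = min(r,c)`. -/
def phi (r c n : ℕ) : Kaq :=
  av ^ (-((min r c : ℤ) * ((min r c : ℤ) + 1) / 2 + ((n : ℤ) + 1) * (min r c : ℤ))) *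
  qv ^ (-((c : ℤ) * ((r : ℤ) * ((r : ℤ) + 1) / 2 + ((n : ℤ) - 1) * (r : ℤ)))) *
  Afun r c n *
  ∏ i ∈ Finset.Icc 1 r, ∏ j ∈ Finset.Icc 1 c, ∏ k ∈ Finset.Icc 1 n,
    (1 - av * qv ^ (i + j + k - 1)) / (1 - av * qv ^ (i + j + k - 2))

/-- `∏_{i<D} ∏_{s<i} u (n+s+1)`, the common shape of the numerator and denominator of `Afun`. -/
def stairProd {K : Type*} [Field K] (u : ℕ → K) (D n : ℕ) : K :=
  ∏ i ∈ range D, ∏ s ∈ range i, u (n + s + 1)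

theorem stairProd_ne_zero {K : Type*} [Field K] {u : ℕ → K} (hu : ∀ k, u (k + 1) ≠ 0) (D n : ℕ) :
    stairProd u D n ≠ 0 :=
  prod_ne_zero_iff.2 fun _ _ => prod_ne_zero_iff.2 fun _ _ => hu _

theorem stairProd_recurrence {K : Type*} [Field K] (u : ℕ → K) (D n : ℕ) :
    stairProd u (D + 1) n * stairProd u D (n + 2) * u (n + 2) ^ D =
      stairProd u (D + 1) (n + 1) * stairProd u D (n + 1) * u (n + 1) ^ D := by
  induction D with
  | zero => simp [stairProd]
  | succ D ih =>
    have hstep (m : ℕ) : ∏ s ∈ range (D + 1), u (m + s + 1) =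
        u (m + 1) * ∏ s ∈ range D, u (m + 1 + s + 1) := by
      rw [prod_range_succ', mul_comm]
      congr 1
      exact prod_congr rfl fun s _ => congrArg u (by ring)
    have hsucc (E m : ℕ) : stairProd u (E + 1) m =
        stairProd u E m * ∏ s ∈ range E, u (m + s + 1) := prod_range_succ _ _
    rw [hsucc (D + 1) n, hsucc (D + 1) (n + 1), hsucc D (n + 2), hsucc D (n + 1), hstep n,
      hstep (n + 1), pow_succ, pow_succ]
    rw [hsucc D (n + 1)] at ih
    linear_combination (u (n + 1) * (∏ s ∈ range D, u (n + 1 + s + 1)) *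
      (∏ s ∈ range D, u (n + 2 + s + 1)) * u (n + 2)) * ih

/-- The box product `∏_{i<r} ∏_{j<c} ∏_{k<n} u (i+j+k+2) / u (i+j+k+1)`. -/
def boxProd {K : Type*} [Field K] (u : ℕ → K) (r c n : ℕ) : K :=
  ∏ i ∈ range r, ∏ j ∈ range c, ∏ k ∈ range n, u (i + j + k + 2) / u (i + j + k + 1)

theorem boxProd_ne_zero {K : Type*} [Field K] {u : ℕ → K} (hu : ∀ k, u (k + 1) ≠ 0) (r c n : ℕ) :
    boxProd u r c n ≠ 0 :=
  prod_ne_zero_iff.2 fun _ _ => prod_ne_zero_iff.2 fun _ _ => prod_ne_zero_iff.2 fun _ _ =>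
    div_ne_zero (hu _) (hu _)

theorem boxProd_succ {K : Type*} [Field K] {u : ℕ → K} (hu : ∀ k, u (k + 1) ≠ 0) (r c n : ℕ) :
    boxProd u r c (n + 1) =
      boxProd u r c n * ∏ i ∈ range r, u (i + c + n + 1) / u (i + n + 1) := by
  have telescope (i : ℕ) : ∏ j ∈ range c, u (i + j + n + 2) / u (i + j + n + 1) =
      u (i + c + n + 1) / u (i + n + 1) := by
    induction c with
    | zero => simp [hu]
    | succ c ih =>
      rw [prod_range_succ, ih, show i + (c + 1) + n + 1 = i + c + n + 2 by ring]
      have := hu (i + c + n)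
      field_simp
  simp only [boxProd, prod_range_succ _ n, prod_mul_distrib, telescope]

theorem boxProd_recurrence {K : Type*} [Field K] {u : ℕ → K} (hu : ∀ k, u (k + 1) ≠ 0)
    (r c n : ℕ) :
    boxProd u (r + 1) (c + 1) n * boxProd u r c (n + 2) * u (r + c + n + 2) =
      boxProd u (r + 1) (c + 1) (n + 1) * boxProd u r c (n + 1) * u (n + 1) := by
  rw [boxProd_succ hu r c (n + 1), boxProd_succ hu (r + 1) (c + 1) n]
  have h : (∏ i ∈ range r, u (i + c + (n + 1) + 1) / u (i + (n + 1) + 1)) * u (r + c + n + 2) =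
      (∏ i ∈ range (r + 1), u (i + (c + 1) + n + 1) / u (i + n + 1)) * u (n + 1) := by
    rw [prod_div_distrib, prod_div_distrib, prod_range_succ,
      prod_range_succ' (fun i => u (i + n + 1))]
    have h₁ : ∏ i ∈ range r, u (i + 1 + n + 1) ≠ 0 := prod_ne_zero_iff.2 fun _ _ => hu _
    have h₂ := hu n
    simp only [show ∀ i, i + c + (n + 1) + 1 = i + (c + 1) + n + 1 by intro; ring,
      show ∀ i, i + (n + 1) + 1 = i + 1 + n + 1 by intro; ring,
      show r + c + n + 2 = r + (c + 1) + n + 1 by ring, zero_add]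
    field_simp
  linear_combination boxProd u (r + 1) (c + 1) n * boxProd u r c (n + 1) * h

theorem av_ne_zero : av ≠ 0 := by
  simp [av]

theorem qv_ne_zero : qv ≠ 0 := by
  simp [qv]

theorem one_sub_av_mul_qv_pow_ne_zero (k : ℕ) : 1 - av * qv ^ k ≠ 0 := by
  have h : (1 - MvPolynomial.X 0 * MvPolynomial.X 1 ^ k : MvPolynomial (Fin 2) ℚ) ≠ 0 := fun h => by
    simpa using congrArg (MvPolynomial.eval ![0, 0]) h
  simpa [av, qv] using (map_ne_zero_iff _ (IsFractionRing.injective _ Kaq)).2 h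

theorem one_sub_qv_pow_succ_ne_zero (k : ℕ) : 1 - qv ^ (k + 1) ≠ 0 := by
  have h : (1 - MvPolynomial.X 1 ^ (k + 1) : MvPolynomial (Fin 2) ℚ) ≠ 0 := fun h => by
    simpa using congrArg (MvPolynomial.eval ![0, 0]) h
  simpa [qv] using (map_ne_zero_iff _ (IsFractionRing.injective _ Kaq)).2 h

theorem poch_qv_inv (x : Kaq) (n i : ℕ) :
    poch (x * qv ^ (n + i)) qv⁻¹ i = ∏ s ∈ range i, (1 - x * qv ^ (n + s + 1)) := by
  rw [poch, ← prod_range_reflect]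
  refine prod_congr rfl fun m hm => ?_
  have hm := mem_range.1 hm
  obtain ⟨t, rfl⟩ : ∃ t, i = m + 1 + t := ⟨i - (m + 1), by omega⟩
  rw [show m + 1 + t - 1 - m = t by omega, mul_assoc, inv_pow,
    show n + (m + 1 + t) = n + m + 1 + t by ring, pow_add _ (n + m + 1),
    mul_inv_cancel_right₀ (pow_ne_zero _ qv_ne_zero)]

theorem prod_Icc_one_eq_prod_range (f : ℕ → Kaq) (n : ℕ) :
    ∏ i ∈ Icc 1 n, f i = ∏ i ∈ range n, f (1 + i) := by
  rw [← Ico_add_one_right_eq_Icc, prod_Ico_eq_prod_range, Nat.add_sub_cancel]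

theorem Afun_eq (r c n : ℕ) :
    Afun r c n = stairProd (fun k => 1 - av * qv ^ k) (min r c) n /
      stairProd (fun k => 1 - qv ^ k) (min r c) n := by
  rw [Afun, stairProd, stairProd, ← prod_div_distrib, prod_Icc_one_eq_prod_range]
  refine prod_congr rfl fun i _ => ?_
  rw [show n + (1 + i) - 1 = n + i by omega, Nat.add_sub_cancel_left, poch_qv_inv]
  congr 1
  simpa using poch_qv_inv 1 n i

theorem phi_eq (r c n : ℕ) :
    phi r c n =
      av ^ (-(((min r c : ℕ) : ℤ) * ((min r c : ℕ) + 1) / 2 + ((n : ℤ) + 1) * (min r c : ℕ))) *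
      qv ^ (-((c : ℤ) * ((r : ℤ) * ((r : ℤ) + 1) / 2 + ((n : ℤ) - 1) * (r : ℤ)))) *
      (stairProd (fun k => 1 - av * qv ^ k) (min r c) n /
        stairProd (fun k => 1 - qv ^ k) (min r c) n) *
      boxProd (fun k => 1 - av * qv ^ k) r c n := by
  have hbox : ∏ i ∈ Icc 1 r, ∏ j ∈ Icc 1 c, ∏ k ∈ Icc 1 n,
      (1 - av * qv ^ (i + j + k - 1)) / (1 - av * qv ^ (i + j + k - 2)) =
        boxProd (fun k => 1 - av * qv ^ k) r c n := by
    simp only [boxProd, prod_Icc_one_eq_prod_range]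
    refine prod_congr rfl fun i _ => prod_congr rfl fun j _ => prod_congr rfl fun k _ => ?_
    rw [show 1 + i + (1 + j) + (1 + k) - 1 = i + j + k + 2 by omega,
      show 1 + i + (1 + j) + (1 + k) - 2 = i + j + k + 1 by omega]
  rw [phi, hbox, Afun_eq, Nat.cast_min]

theorem phi_succ_ratio (r c n : ℕ) :
    phi r c n / phi r c (n + 1) =
      av ^ min r c * qv ^ (c * r) *
      (stairProd (fun k => 1 - av * qv ^ k) (min r c) n /
        stairProd (fun k => 1 - av * qv ^ k) (min r c) (n + 1)) *
      (stairProd (fun k => 1 - qv ^ k) (min r c) (n + 1) /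
        stairProd (fun k => 1 - qv ^ k) (min r c) n) *
      (boxProd (fun k => 1 - av * qv ^ k) r c n / boxProd (fun k => 1 - av * qv ^ k) r c (n + 1)) := by
  have hexp {x : Kaq} (hx : x ≠ 0) (e f : ℤ) (m : ℕ) (h : e = f + m) : x ^ e = x ^ f * x ^ m := by
    rw [h, zpow_add₀ hx, zpow_natCast]
  rw [phi_eq r c n, phi_eq r c (n + 1)]
  generalize hd : min r c = d
  rw [hexp av_ne_zero _ (-((d : ℤ) * (d + 1) / 2 + (((n + 1 : ℕ) : ℤ) + 1) * d)) d
      (by push_cast; ring),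
    hexp qv_ne_zero _ (-((c : ℤ) * ((r : ℤ) * (r + 1) / 2 + (((n + 1 : ℕ) : ℤ) - 1) * r))) (c * r)
      (by push_cast; ring)]
  have ha := zpow_ne_zero (-((d : ℤ) * (d + 1) / 2 + (((n + 1 : ℕ) : ℤ) + 1) * d)) av_ne_zero
  have hq := zpow_ne_zero
    (-((c : ℤ) * ((r : ℤ) * (r + 1) / 2 + (((n + 1 : ℕ) : ℤ) - 1) * r))) qv_ne_zero
  generalize av ^ (-((d : ℤ) * (d + 1) / 2 + (((n + 1 : ℕ) : ℤ) + 1) * d)) = x at *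
  generalize qv ^ (-((c : ℤ) * ((r : ℤ) * (r + 1) / 2 + (((n + 1 : ℕ) : ℤ) - 1) * r))) = y at *
  have hu (m : ℕ) := stairProd_ne_zero (u := fun k => 1 - av * qv ^ k)
    (fun k => one_sub_av_mul_qv_pow_ne_zero (k + 1)) d m
  have hv (m : ℕ) := stairProd_ne_zero (u := fun k => 1 - qv ^ k) one_sub_qv_pow_succ_ne_zero d m
  have hb (m : ℕ) := boxProd_ne_zero (u := fun k => 1 - av * qv ^ k)
    (fun k => one_sub_av_mul_qv_pow_ne_zero (k + 1)) r c m
  have := hu n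
  have := hu (n + 1)
  have := hv n
  have := hv (n + 1)
  have := hb n
  have := hb (n + 1)
  field_simp

/-- **Second ratio simplification in the recurrence check**: for `r, c, n ≥ 1`, `d = min(r,c)`,
`[φ(r,c,n-1)/φ(r,c,n)] · [φ(r-1,c-1,n+1)/φ(r-1,c-1,n)]`
`= a q^{r+c-1} [(1-aq^n)^{d-1}/(1-q^n)^{d-1}] [(1-q^{n+1})^{d-1}/(1-aq^{n+1})^{d-1}]`
`· (1-aq^n)/(1-aq^{r+c+n-1})` in `ℚ(a,q)`. -/
theorem phi_second_ratio (r c n : ℕ) (hr : 1 ≤ r) (hc : 1 ≤ c) (hn : 1 ≤ n) :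
    phi r c (n - 1) / phi r c n * (phi (r - 1) (c - 1) (n + 1) / phi (r - 1) (c - 1) n) =
      av * qv ^ (r + c - 1) *
        ((1 - av * qv ^ n) ^ (min r c - 1) / (1 - qv ^ n) ^ (min r c - 1)) *
        ((1 - qv ^ (n + 1)) ^ (min r c - 1) / (1 - av * qv ^ (n + 1)) ^ (min r c - 1)) *
        (1 - av * qv ^ n) / (1 - av * qv ^ (r + c + n - 1)) := by
  obtain ⟨r, rfl⟩ := Nat.exists_eq_add_of_le' hr
  obtain ⟨c, rfl⟩ := Nat.exists_eq_add_of_le' hc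
  obtain ⟨n, rfl⟩ := Nat.exists_eq_add_of_le' hn
  have hu (k : ℕ) := one_sub_av_mul_qv_pow_ne_zero (k + 1)
  have hv := one_sub_qv_pow_succ_ne_zero
  have hU := stairProd_recurrence (fun k => 1 - av * qv ^ k) (min r c) n
  have hV := stairProd_recurrence (fun k => 1 - qv ^ k) (min r c) n
  have hB := boxProd_recurrence (u := fun k => 1 - av * qv ^ k) hu r c n
  have hU₀ := stairProd_ne_zero (u := fun k => 1 - av * qv ^ k) hu
  have hV₀ := stairProd_ne_zero (u := fun k => 1 - qv ^ k) hv
  have hB₀ := boxProd_ne_zero (u := fun k => 1 - av * qv ^ k) hu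
  simp only [Nat.add_sub_cancel]
  rw [← inv_div (phi r c (n + 1)), phi_succ_ratio, phi_succ_ratio,
    show min (r + 1) (c + 1) = min r c + 1 by omega, Nat.add_sub_cancel,
    show r + 1 + (c + 1) - 1 = r + c + 1 by omega,
    show r + 1 + (c + 1) + (n + 1) - 1 = r + c + n + 2 by omega]
  simp only [show n + 1 + 1 = n + 2 from rfl]
  generalize min r c = d at *
  have hratio {x y z w s t : Kaq} (hy : y ≠ 0) (hw : w ≠ 0) (ht : t ≠ 0)
      (h : x * z * t = y * w * s) : x / y * (z / w) = s / t := by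
    field_simp
    linear_combination h
  have hU' := hratio (hU₀ _ _) (hU₀ _ _) (pow_ne_zero _ (hu _)) hU
  have hV' := hratio (hV₀ _ _) (hV₀ _ _) (pow_ne_zero _ (hv _)) hV
  have hB' := hratio (hB₀ _ _ _) (hB₀ _ _ _) (hu _) hB
  have hpow : av ^ (d + 1) * qv ^ ((c + 1) * (r + 1)) * (av ^ d * qv ^ (c * r))⁻¹ =
      av * qv ^ (r + c + 1) := by
    have := av_ne_zero
    have := qv_ne_zero
    field_simp
    ring
  have hV'' := congrArg (·⁻¹) hV'
  simp only [mul_inv, inv_div] at hV'' hpow ⊢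
  calc _ = (av ^ (d + 1) * qv ^ ((c + 1) * (r + 1)) * ((av ^ d)⁻¹ * (qv ^ (c * r))⁻¹)) *
        (stairProd (fun k => 1 - av * qv ^ k) (d + 1) n /
          stairProd (fun k => 1 - av * qv ^ k) (d + 1) (n + 1) *
          (stairProd (fun k => 1 - av * qv ^ k) d (n + 2) /
          stairProd (fun k => 1 - av * qv ^ k) d (n + 1))) *
        (stairProd (fun k => 1 - qv ^ k) (d + 1) (n + 1) /
          stairProd (fun k => 1 - qv ^ k) (d + 1) n *
          (stairProd (fun k => 1 - qv ^ k) d (n + 1) /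
          stairProd (fun k => 1 - qv ^ k) d (n + 2))) *
        (boxProd (fun k => 1 - av * qv ^ k) (r + 1) (c + 1) n /
          boxProd (fun k => 1 - av * qv ^ k) (r + 1) (c + 1) (n + 1) *
          (boxProd (fun k => 1 - av * qv ^ k) r c (n + 2) /
          boxProd (fun k => 1 - av * qv ^ k) r c (n + 1))) := by ring
    _ = _ := by
      rw [hpow, hU', hV'', hB']
      ring

end
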